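/- Let u_ε be a C² solution of εΔu_ε = (1/ε)W'(u_ε) satisfying |u_ε| ≤ 1 and the Modica inequality (ε/2)|∇u_ε|² ≤ (1/ε)W(u_ε) on an open set containing B_1(X). Then the rescaled energy r ↦ r^{-n} ∫_{B_r(X)} [ (ε/2)|∇u_ε|² + (1/ε)W(u_ε) ] is non-decreasing in r ∈ (0,1). -/

import Mathlib

/-- The Laplacian of `f : ℝ^d → ℝ`, as the sum of pure second derivatives in the
coordinate directions. -/
noncomputable def lap {d : ℕ} (f : EuclideanSpace ℝ (Fin d) → ℝ)
    (x : EuclideanSpace ℝ (Fin d)) : ℝ :=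
  ∑ i : Fin d,
    fderiv ℝ (fun y => fderiv ℝ f y (EuclideanSpace.single i 1)) x
      (EuclideanSpace.single i 1)

open MeasureTheory Metric Filter Topology

lemma mono_clm_apply {d : ℕ} (L : EuclideanSpace ℝ (Fin d) →L[ℝ] ℝ)
    (v : EuclideanSpace ℝ (Fin d)) :
    L v = ∑ i, v i * L (EuclideanSpace.single i 1) := by
  have h := (EuclideanSpace.basisFun (Fin d) ℝ).sum_repr v
  conv_lhs => rw [← h]
  simp

lemma mono_norm_sq {d : ℕ} (L : EuclideanSpace ℝ (Fin d) →L[ℝ] ℝ) :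
    ‖L‖ ^ 2 = ∑ i, (L (EuclideanSpace.single i 1)) ^ 2 := by
  have h := (InnerProductSpace.toDual ℝ (EuclideanSpace ℝ (Fin d))).symm.norm_map L
  rw [← h, EuclideanSpace.norm_sq_eq]
  refine Finset.sum_congr rfl fun i _ => ?_
  have h2 := InnerProductSpace.toDual_symm_apply (𝕜 := ℝ) (x := EuclideanSpace.single i (1:ℝ)) (y := L)
  rw [← h2, EuclideanSpace.inner_single_right]
  simp

/-- the algebra behind the divergence identity -/
lemma mono_alg {m : ℕ} (ε w w1 : ℝ) (hε : 0 < ε) (v D : Fin m → ℝ) (H : Fin m → Fin m → ℝ)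
    (hsym : ∀ i j, H i j = H j i) (heq : ε * ∑ i, H i i = (1/ε) * w1) :
    ∑ i, ((ε/2 * ∑ j, 2 * D j * H j i + (1/ε) * (w1 * D i)) * v i
      + (ε/2 * ∑ j, D j ^ 2 + (1/ε) * w)
      - (ε * (D i + ∑ j, v j * H j i) * D i + ε * (∑ j, v j * D j) * H i i))
    = m * (ε/2 * ∑ j, D j ^ 2 + (1/ε) * w) - ε * ∑ j, D j ^ 2 := by
  have h1 : ∑ i, (∑ j, D j * H j i) * v i = ∑ i, (∑ j, v j * H j i) * D i := by
    simp_rw [Finset.sum_mul]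
    rw [Finset.sum_comm]
    refine Finset.sum_congr rfl fun i _ => Finset.sum_congr rfl fun j _ => ?_
    rw [hsym i j]; ring
  have e1 : ∀ i, ((ε/2 * ∑ j, 2 * D j * H j i + (1/ε) * (w1 * D i)) * v i
      + (ε/2 * ∑ j, D j ^ 2 + (1/ε) * w)
      - (ε * (D i + ∑ j, v j * H j i) * D i + ε * (∑ j, v j * D j) * H i i))
      = ε * ((∑ j, D j * H j i) * v i) - ε * ((∑ j, v j * H j i) * D i)
        + (1/ε) * w1 * (v i * D i) + (ε/2 * ∑ j, D j ^ 2 + (1/ε) * w)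
        - ε * D i ^ 2 - ε * (∑ j, v j * D j) * H i i := by
    intro i
    simp_rw [mul_assoc (2:ℝ), ← Finset.mul_sum]
    ring
  simp_rw [e1]
  simp only [Finset.sum_add_distrib, Finset.sum_sub_distrib, ← Finset.mul_sum, h1]
  simp only [Finset.sum_const, Finset.card_univ, Fintype.card_fin, ← heq, nsmul_eq_mul]
  ring

/-- energy density -/
noncomputable def monoE {m : ℕ} (ε : ℝ) (W : ℝ → ℝ) (u : EuclideanSpace ℝ (Fin m) → ℝ)
    (x : EuclideanSpace ℝ (Fin m)) : ℝ :=
  ε/2 * ∑ j, (fderiv ℝ u x (EuclideanSpace.single j 1)) ^ 2 + (1/ε) * W (u x)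

/-- the stress-energy vector field -/
noncomputable def monoV {m : ℕ} (ε : ℝ) (W : ℝ → ℝ) (u : EuclideanSpace ℝ (Fin m) → ℝ)
    (X : EuclideanSpace ℝ (Fin m)) (i : Fin m) (x : EuclideanSpace ℝ (Fin m)) : ℝ :=
  monoE ε W u x * (x i - X i) -
    ε * (∑ j, (x j - X j) * fderiv ℝ u x (EuclideanSpace.single j 1)) *
      fderiv ℝ u x (EuclideanSpace.single i 1)

lemma mono_contD {m : ℕ} {Ω : Set (EuclideanSpace ℝ (Fin m))} (hΩ : IsOpen Ω)
    {u : EuclideanSpace ℝ (Fin m) → ℝ} (hu : ContDiffOn ℝ 2 u Ω) (v : EuclideanSpace ℝ (Fin m)) :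
    ContDiffOn ℝ 1 (fun x => fderiv ℝ u x v) Ω :=
  (hu.fderiv_of_isOpen hΩ (by norm_num)).clm_apply contDiffOn_const

lemma mono_contE {m : ℕ} {Ω : Set (EuclideanSpace ℝ (Fin m))} (hΩ : IsOpen Ω) (ε : ℝ)
    {u : EuclideanSpace ℝ (Fin m) → ℝ} (hu : ContDiffOn ℝ 2 u Ω) {W : ℝ → ℝ}
    (hW : ContDiff ℝ 1 W) : ContDiffOn ℝ 1 (monoE ε W u) Ω := by
  unfold monoE
  refine (contDiffOn_const.mul (ContDiffOn.sum fun j _ => (mono_contD hΩ hu _).pow 2)).add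
    (contDiffOn_const.mul (hW.comp_contDiffOn (hu.of_le (by norm_num))))

lemma mono_contV {m : ℕ} {Ω : Set (EuclideanSpace ℝ (Fin m))} (hΩ : IsOpen Ω) (ε : ℝ)
    {u : EuclideanSpace ℝ (Fin m) → ℝ} (hu : ContDiffOn ℝ 2 u Ω) {W : ℝ → ℝ}
    (hW : ContDiff ℝ 1 W) (X : EuclideanSpace ℝ (Fin m)) (i : Fin m) :
    ContDiffOn ℝ 1 (monoV ε W u X i) Ω := by
  unfold monoV
  have hc : ∀ j : Fin m, ContDiffOn ℝ 1 (fun x : EuclideanSpace ℝ (Fin m) => x j - X j) Ω := by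
    intro j
    exact (ContDiff.sub (by fun_prop) contDiff_const).contDiffOn
  refine ((mono_contE hΩ ε hu hW).mul (hc i)).sub
    ((contDiffOn_const.mul (ContDiffOn.sum fun j _ => (hc j).mul (mono_contD hΩ hu _))).mul
      (mono_contD hΩ hu _))


lemma mono_div {m : ℕ} {Ω : Set (EuclideanSpace ℝ (Fin m))} (hΩ : IsOpen Ω) (ε : ℝ) (hε : 0 < ε)
    {u : EuclideanSpace ℝ (Fin m) → ℝ} (hu : ContDiffOn ℝ 2 u Ω) {W : ℝ → ℝ}
    (hW : ContDiff ℝ 1 W) (X : EuclideanSpace ℝ (Fin m)) {x : EuclideanSpace ℝ (Fin m)}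
    (hx : x ∈ Ω) (heq : ε * lap u x = (1/ε) * deriv W (u x)) :
    ∑ i, fderiv ℝ (monoV ε W u X i) x (EuclideanSpace.single i 1)
      = m * monoE ε W u x - ε * ∑ j, (fderiv ℝ u x (EuclideanSpace.single j 1)) ^ 2 := by
  have hxn := hΩ.mem_nhds hx
  have huA : ContDiffAt ℝ 2 u x := hu.contDiffAt hxn
  set b : Fin m → EuclideanSpace ℝ (Fin m) := fun i => EuclideanSpace.single i 1 with hb
  have key : ∀ (f : EuclideanSpace ℝ (Fin m) → ℝ) (v : EuclideanSpace ℝ (Fin m)),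
      DifferentiableAt ℝ f x → HasDerivAt (fun t : ℝ => f (x + t • v)) (fderiv ℝ f x v) 0 :=
    fun f v hf => hf.hasFDerivAt.hasLineDerivAt v
  have hD : ∀ i j, HasDerivAt (fun t : ℝ => fderiv ℝ u (x + t • b i) (b j))
      (fderiv ℝ (fun y => fderiv ℝ u y (b j)) x (b i)) 0 := by
    intro i j
    exact key (fun y => fderiv ℝ u y (b j)) (b i)
      (((mono_contD hΩ hu (b j)).contDiffAt hxn).differentiableAt (by norm_num))
  have hf : DifferentiableAt ℝ (fderiv ℝ u) x :=
    (huA.fderiv_right (m := 1) (by norm_num)).differentiableAt (by norm_num)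
  have hsym : ∀ i j, fderiv ℝ (fun y => fderiv ℝ u y (b i)) x (b j)
      = fderiv ℝ (fun y => fderiv ℝ u y (b j)) x (b i) := by
    have h2 : ∀ i j, fderiv ℝ (fun y => fderiv ℝ u y (b i)) x (b j) =
        fderiv ℝ (fderiv ℝ u) x (b j) (b i) := by
      intro i j
      rw [fderiv_clm_apply hf (by fun_prop)]
      simp
    intro i j
    rw [h2, h2]
    exact (huA.isSymmSndFDerivAt (by simp)).eq _ _
  have hcoord : ∀ i j, HasDerivAt (fun t : ℝ => (x + t • b i) j - X j)
      (if j = i then 1 else 0) 0 := by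
    intro i j
    have h1 : HasDerivAt (fun t : ℝ => x j + t * (if j = i then 1 else 0) - X j)
        (1 * (if j = i then 1 else 0)) 0 :=
      (((hasDerivAt_id (0:ℝ)).mul_const _).const_add _).sub_const _
    rw [one_mul] at h1
    refine h1.congr_of_eventuallyEq (Eventually.of_forall fun t => ?_)
    simp [hb, Pi.single_apply]
  have hWu : ∀ i, HasDerivAt (fun t : ℝ => W (u (x + t • b i)))
      (deriv W (u x) * fderiv ℝ u x (b i)) 0 := by
    intro i
    have h1 : HasDerivAt W (deriv W (u x)) (u (x + (0:ℝ) • b i)) := by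
      rw [zero_smul, add_zero]
      exact ((hW.differentiable (by norm_num)) _).hasDerivAt
    exact h1.comp (0:ℝ) (key u (b i) (huA.differentiableAt (by norm_num)))
  have hE : ∀ i, HasDerivAt (fun t : ℝ => monoE ε W u (x + t • b i))
      (ε/2 * ∑ j, 2 * fderiv ℝ u x (b j) * fderiv ℝ (fun y => fderiv ℝ u y (b j)) x (b i)
        + (1/ε) * (deriv W (u x) * fderiv ℝ u x (b i))) 0 := by
    intro i
    have h1 := HasDerivAt.fun_add (HasDerivAt.const_mul (ε/2)
      (HasDerivAt.fun_sum (u := Finset.univ) fun j _ => (HasDerivAt.fun_pow (hD i j) 2)))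
      (HasDerivAt.const_mul (1/ε) (hWu i))
    refine h1.congr_deriv ?_
    simp
  have hV : ∀ i, HasDerivAt (fun t : ℝ => monoV ε W u X i (x + t • b i))
      ((ε/2 * ∑ j, 2 * fderiv ℝ u x (b j) * fderiv ℝ (fun y => fderiv ℝ u y (b j)) x (b i)
        + (1/ε) * (deriv W (u x) * fderiv ℝ u x (b i))) * (x i - X i)
      + (ε/2 * ∑ j, (fderiv ℝ u x (b j)) ^ 2 + (1/ε) * W (u x))
      - (ε * (fderiv ℝ u x (b i) + ∑ j, (x j - X j) *
          fderiv ℝ (fun y => fderiv ℝ u y (b j)) x (b i)) * fderiv ℝ u x (b i)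
        + ε * (∑ j, (x j - X j) * fderiv ℝ u x (b j)) *
          fderiv ℝ (fun y => fderiv ℝ u y (b i)) x (b i))) 0 := by
    intro i
    have h1 := HasDerivAt.fun_sub (HasDerivAt.fun_mul (hE i) (hcoord i i))
      (HasDerivAt.fun_mul (HasDerivAt.const_mul ε (HasDerivAt.fun_sum (u := Finset.univ) fun j _ =>
        HasDerivAt.fun_mul (hcoord i j) (hD i j))) (hD i i))
    refine h1.congr_deriv ?_
    simp only [zero_smul, add_zero, Finset.sum_add_distrib, ite_mul, one_mul, zero_mul,
      Finset.sum_ite_eq', Finset.mem_univ, if_true, mul_one, monoE]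
    simp [hb]
  have hV' : ∀ i, fderiv ℝ (monoV ε W u X i) x (b i) = _ := fun i =>
    (key _ (b i) (((mono_contV hΩ ε hu hW X i).contDiffAt hxn).differentiableAt
      (by norm_num))).unique (hV i)
  rw [Finset.sum_congr rfl fun i _ => hV' i]
  rw [mono_alg ε (W (u x)) (deriv W (u x)) hε (fun i => x i - X i) (fun j => fderiv ℝ u x (b j))
    (fun j i => fderiv ℝ (fun y => fderiv ℝ u y (b j)) x (b i)) hsym heq]
  rfl

/-- the radial Lipschitz test function -/
noncomputable def monoEta {E : Type*} [NormedAddCommGroup E] (n : ℕ) (s r : ℝ) (X x : E) : ℝ :=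
  max 0 ((max ‖x - X‖ s ^ n)⁻¹ - (r ^ n)⁻¹)

lemma monoEta_lip {E : Type*} [NormedAddCommGroup E] (n : ℕ) {s r : ℝ} (hs : 0 < s) (X : E) :
    ∃ C, LipschitzWith C (monoEta n s r X) := by
  have h1 : LipschitzOnWith (Real.toNNReal (n * (s⁻¹) ^ (n - 1) * (s ^ 2)⁻¹))
      (fun t : ℝ => (t⁻¹) ^ n) (Set.Ici s) := by
    refine Convex.lipschitzOnWith_of_nnnorm_hasDerivWithin_le (convex_Ici s)
      (f' := fun t : ℝ => (n:ℝ) * (t⁻¹) ^ (n - 1) * (-(t ^ 2)⁻¹)) ?_ ?_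
    · intro t ht
      have ht0 : t ≠ 0 := (lt_of_lt_of_le hs ht).ne'
      exact ((hasDerivAt_inv ht0).pow n).hasDerivWithinAt
    · intro t ht
      have hts : s ≤ t := ht
      have ht0 : 0 < t := lt_of_lt_of_le hs ht
      rw [← NNReal.coe_le_coe, coe_nnnorm, Real.coe_toNNReal _ (by positivity), Real.norm_eq_abs,
        mul_neg, abs_neg, abs_of_nonneg (by positivity)]
      gcongr
  have h2 : LipschitzWith 1 (fun x : E => max ‖x - X‖ s) := by
    have h3 : LipschitzWith 1 (fun x : E => ‖x - X‖) := by
      simpa [dist_eq_norm] using LipschitzWith.dist_left X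
    exact h3.max_const s
  have h4 := h1.comp (f := fun x : E => max ‖x - X‖ s) (s := Set.univ)
    (lipschitzOnWith_univ.2 h2) (fun x _ => Set.mem_Ici.2 (le_max_right _ _))
  rw [lipschitzOnWith_univ] at h4
  have h5 := (h4.sub (LipschitzWith.const ((r ^ n)⁻¹))).const_max 0
  have h6 : monoEta n s r X = fun x =>
      max 0 (((fun t : ℝ => t⁻¹ ^ n) ∘ fun x => max ‖x - X‖ s) x - (r ^ n)⁻¹) := by
    funext x
    simp [monoEta]
  exact ⟨_, h6 ▸ h5⟩

lemma monoEta_nonneg {E : Type*} [NormedAddCommGroup E] (n : ℕ) (s r : ℝ) (X x : E) :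
    0 ≤ monoEta n s r X x := le_max_left _ _

lemma monoEta_in {E : Type*} [NormedAddCommGroup E] (n : ℕ) {s r : ℝ} (hs : 0 < s) (hsr : s < r)
    {X x : E} (hx : ‖x - X‖ < s) : monoEta n s r X x = (s ^ n)⁻¹ - (r ^ n)⁻¹ := by
  unfold monoEta
  rw [max_eq_right hx.le, max_eq_right]
  rw [sub_nonneg]
  gcongr

lemma monoEta_mid {E : Type*} [NormedAddCommGroup E] (n : ℕ) {s r : ℝ} (hs : 0 < s)
    {X x : E} (hx : s < ‖x - X‖) (hx2 : ‖x - X‖ < r) :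
    monoEta n s r X x = (‖x - X‖ ^ n)⁻¹ - (r ^ n)⁻¹ := by
  unfold monoEta
  rw [max_eq_left hx.le, max_eq_right]
  rw [sub_nonneg]
  have : 0 < ‖x - X‖ := hs.trans hx
  gcongr

lemma monoEta_out {E : Type*} [NormedAddCommGroup E] (n : ℕ) {s r : ℝ} (hs : 0 < s) (hsr : s < r)
    {X x : E} (hx : r < ‖x - X‖) : monoEta n s r X x = 0 := by
  unfold monoEta
  rw [max_eq_left (hsr.trans hx).le, max_eq_left]
  rw [sub_nonpos]
  have : 0 < r := hs.trans hsr
  gcongr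

lemma monoEta_cont {E : Type*} [NormedAddCommGroup E] [InnerProductSpace ℝ E] (X x v : E) :
    Tendsto (fun t : ℝ => ‖x + t • v - X‖) (𝓝 0) (𝓝 ‖x - X‖) := by
  have : Continuous (fun t : ℝ => ‖x + t • v - X‖) := by fun_prop
  simpa using this.tendsto 0

lemma monoEta_deriv_in {E : Type*} [NormedAddCommGroup E] [InnerProductSpace ℝ E]
    (n : ℕ) {s r : ℝ} (hs : 0 < s) (hsr : s < r)
    {X x : E} (hx : ‖x - X‖ < s) (v : E) :
    deriv (fun t : ℝ => monoEta n s r X (x + t • v)) 0 = 0 := by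
  have : (fun t : ℝ => monoEta n s r X (x + t • v)) =ᶠ[𝓝 0] fun _ => (s ^ n)⁻¹ - (r ^ n)⁻¹ := by
    filter_upwards [(monoEta_cont X x v).eventually_lt_const hx] with t ht
    exact monoEta_in n hs hsr ht
  rw [this.deriv_eq]; simp

lemma monoEta_deriv_out {E : Type*} [NormedAddCommGroup E] [InnerProductSpace ℝ E]
    (n : ℕ) {s r : ℝ} (hs : 0 < s) (hsr : s < r)
    {X x : E} (hx : r < ‖x - X‖) (v : E) :
    deriv (fun t : ℝ => monoEta n s r X (x + t • v)) 0 = 0 := by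
  have : (fun t : ℝ => monoEta n s r X (x + t • v)) =ᶠ[𝓝 0] fun _ => 0 := by
    filter_upwards [(monoEta_cont X x v).eventually_const_lt hx] with t ht
    exact monoEta_out n hs hsr ht
  rw [this.deriv_eq]; simp

lemma monoEta_deriv_mid {E : Type*} [NormedAddCommGroup E] [InnerProductSpace ℝ E]
    (k : ℕ) {s r : ℝ} (hs : 0 < s)
    {X x : E} (hx : s < ‖x - X‖) (hx2 : ‖x - X‖ < r) (v : E) :
    deriv (fun t : ℝ => monoEta (k+1) s r X (x + t • v)) 0
      = - ((k + 1 : ℝ) * (‖x - X‖ ^ (k + 3))⁻¹ * inner ℝ (x - X) v) := by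
  have : (fun t : ℝ => monoEta (k+1) s r X (x + t • v)) =ᶠ[𝓝 0]
      fun t => (‖x + t • v - X‖ ^ (k+1))⁻¹ - (r ^ (k+1))⁻¹ := by
    filter_upwards [(monoEta_cont X x v).eventually_const_lt hx,
      (monoEta_cont X x v).eventually_lt_const hx2] with t ht ht2
    exact monoEta_mid _ hs ht ht2
  rw [this.deriv_eq]
  have hpos : 0 < ‖x - X‖ := hs.trans hx
  have hl : HasDerivAt (fun t : ℝ => x + t • v - X) v 0 := by
    simpa using (((hasDerivAt_id (0:ℝ)).smul_const v).const_add x).sub_const X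
  have h1 : HasDerivAt (fun t : ℝ => ‖x + t • v - X‖) (inner ℝ (x - X) v / ‖x - X‖) 0 := by
    have h2 := (hl.norm_sq).sqrt (by simpa using hpos.ne')
    simp only [Real.sqrt_sq (norm_nonneg _)] at h2
    refine h2.congr_deriv ?_
    simp only [zero_smul, add_zero]
    field_simp
  have h3 := ((h1.fun_pow (k+1)).fun_inv (by simpa using fun h => absurd h (norm_pos_iff.1 hpos))).sub_const ((r ^ (k+1))⁻¹)
  rw [h3.deriv]
  simp only [zero_smul, add_zero, Nat.add_sub_cancel]
  push_cast
  field_simp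
  ring

lemma mono_ibp {E : Type*} [NormedAddCommGroup E] [InnerProductSpace ℝ E] [FiniteDimensional ℝ E]
    [MeasurableSpace E] [BorelSpace E] (μ : Measure E) [μ.IsAddHaarMeasure]
    {f g : E → ℝ} {C : NNReal} (hf : LipschitzWith C f) (hg : ContDiff ℝ 1 g)
    (hgc : HasCompactSupport g) (v : E) :
    Integrable (fun x => deriv (fun t : ℝ => f (x + t • v)) 0 * g x + f x * fderiv ℝ g x v) μ ∧
    ∫ x, (deriv (fun t : ℝ => f (x + t • v)) 0 * g x + f x * fderiv ℝ g x v) ∂μ = 0 := by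
  obtain ⟨D, hD⟩ := hg.lipschitzWith_of_hasCompactSupport hgc one_ne_zero
  have h := hf.integral_lineDeriv_mul_eq (μ := μ) hD hgc v
  have hi1 : Integrable (fun x => deriv (fun t : ℝ => f (x + t • v)) 0 * g x) μ := by
    have hgi : Integrable g μ := hg.continuous.integrable_of_hasCompactSupport hgc
    have := hgi.bdd_mul (f := fun x => lineDeriv ℝ f x v) (c := C * ‖v‖)
      (aestronglyMeasurable_lineDeriv hf.continuous μ)
      (.of_forall fun _x ↦ norm_lineDeriv_le_of_lipschitz ℝ hf)
    exact this
  have hi2 : Integrable (fun x => f x * fderiv ℝ g x v) μ := by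
    refine Continuous.integrable_of_hasCompactSupport ?_ ?_
    · exact hf.continuous.mul ((hg.continuous_fderiv one_ne_zero).clm_apply continuous_const)
    · exact (hgc.fderiv_apply ℝ v).mul_left
  refine ⟨hi1.add hi2, ?_⟩
  rw [integral_add hi1 hi2]
  have h2 : ∫ x, lineDeriv ℝ g x (-v) * f x ∂μ = - ∫ x, f x * fderiv ℝ g x v ∂μ := by
    rw [← integral_neg]
    congr 1
    ext x
    rw [((hg.differentiable one_ne_zero) x).lineDeriv_eq_fderiv]
    simp [mul_comm]
  rw [h2] at h
  change ∫ x, lineDeriv ℝ f x v * g x ∂μ + _ = 0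
  rw [h]; ring

/-- Monotonicity formula: for a solution of `εΔu = (1/ε)W'(u)` with `|u| ≤ 1`
satisfying the Modica inequality, the normalized energy
`r^{-n} ∫_{B_r(X)} (ε/2)|∇u|² + (1/ε)W(u)` is non-decreasing in `r ∈ (0,1)`. -/
theorem monotonicity_formula {n : ℕ} (ε : ℝ) (hε : 0 < ε)
    (Ω : Set (EuclideanSpace ℝ (Fin (n+1)))) (hΩ : IsOpen Ω)
    (X : EuclideanSpace ℝ (Fin (n+1))) (hball : Metric.closedBall X 1 ⊆ Ω)
    (u : EuclideanSpace ℝ (Fin (n+1)) → ℝ) (W : ℝ → ℝ)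
    (hu : ContDiffOn ℝ 2 u Ω) (hW : ContDiff ℝ 1 W) (hWnn : ∀ s, 0 ≤ W s)
    (hbd : ∀ x ∈ Ω, |u x| ≤ 1)
    (heq : ∀ x ∈ Ω, ε * lap u x = (1/ε) * deriv W (u x))
    (hModica : ∀ x ∈ Ω, (ε/2) * ‖fderiv ℝ u x‖ ^ 2 ≤ (1/ε) * W (u x)) :
    MonotoneOn (fun r : ℝ =>
      r ^ (-(n : ℝ)) *
        ∫ y in Metric.ball X r, ((ε/2) * ‖fderiv ℝ u y‖ ^ 2 + (1/ε) * W (u y)))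
      (Set.Ioo (0:ℝ) 1) := by
  classical
  set e := monoE ε W u with he
  have hee : ∀ y, (ε/2) * ‖fderiv ℝ u y‖ ^ 2 + (1/ε) * W (u y) = e y := by
    intro y
    rw [mono_norm_sq, he, monoE]
  simp only [hee]
  have hcont : ContinuousOn e (closedBall X 1) :=
    ((mono_contE hΩ ε hu hW).continuousOn).mono hball
  have hIntCl : IntegrableOn e (closedBall X 1) :=
    hcont.integrableOn_compact (isCompact_closedBall X 1)
  have hIntOn : ∀ t, t < 1 → IntegrableOn e (ball X t) := fun t ht =>
    hIntCl.mono_set ((ball_subset_ball ht.le).trans ball_subset_closedBall)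
  have hepos : ∀ y, 0 ≤ e y := by
    intro y
    rw [← hee]
    have := hWnn (u y)
    positivity
  intro s hs r hr hsr
  obtain ⟨hs0, hs1⟩ := hs
  obtain ⟨hr0, hr1⟩ := hr
  beta_reduce
  rw [Real.rpow_neg hs0.le, Real.rpow_neg hr0.le, Real.rpow_natCast, Real.rpow_natCast]
  rcases hsr.eq_or_lt with rfl | hsr
  · exact le_rfl
  rcases n with _ | k
  · simp only [pow_zero, inv_one, one_mul]
    exact setIntegral_mono_set (hIntOn r hr1) (Eventually.of_forall hepos)
      (ball_subset_ball hsr.le).eventuallyLE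
  let χ : ContDiffBump X := ⟨r, 1, hr0, hr1⟩
  set b : Fin (k+1+1) → EuclideanSpace ℝ (Fin (k+1+1)) := fun i => EuclideanSpace.single i 1 with hb
  let G : Fin (k+1+1) → EuclideanSpace ℝ (Fin (k+1+1)) → ℝ := fun i y => χ y * monoV ε W u X i y
  have hGc : ∀ i, HasCompactSupport (G i) := fun i => χ.hasCompactSupport.mul_right
  have hG : ∀ i, ContDiff ℝ 1 (G i) := by
    intro i
    rw [contDiff_iff_contDiffAt]
    intro x
    by_cases hx : x ∈ tsupport χ
    · rw [χ.tsupport_eq] at hx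
      exact χ.contDiffAt.mul ((mono_contV hΩ ε hu hW X i).contDiffAt (hΩ.mem_nhds (hball hx)))
    · rw [notMem_tsupport_iff_eventuallyEq] at hx
      have : G i =ᶠ[𝓝 x] fun _ => 0 := by
        filter_upwards [hx] with y hy
        simp [G, hy]
      exact contDiffAt_const.congr_of_eventuallyEq this
  obtain ⟨C, hC⟩ := monoEta_lip (k+1) (r := r) hs0 X
  have hib := fun i => mono_ibp (volume : Measure (EuclideanSpace ℝ (Fin (k+1+1)))) hC (hG i) (hGc i) (b i)
  have hPi : Integrable (fun x => ∑ i, (deriv (fun t : ℝ => monoEta (k+1) s r X (x + t • b i)) 0 * G i x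
      + monoEta (k+1) s r X x * fderiv ℝ (G i) x (b i))) volume :=
    integrable_finsetSum _ fun i _ => (hib i).1
  have hP0 : ∫ x, ∑ i, (deriv (fun t : ℝ => monoEta (k+1) s r X (x + t • b i)) 0 * G i x
      + monoEta (k+1) s r X x * fderiv ℝ (G i) x (b i)) = 0 := by
    rw [integral_finsetSum _ fun i _ => (hib i).1]
    exact Finset.sum_eq_zero fun i _ => (hib i).2
  have hQs : Integrable ((ball X s).indicator e) volume :=
    (integrable_indicator_iff measurableSet_ball).2 (hIntOn s hs1)
  have hQr : Integrable ((ball X r).indicator e) volume :=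
    (integrable_indicator_iff measurableSet_ball).2 (hIntOn r hr1)
  have hQ : ∫ x, ((k + 1 : ℝ) * ((s ^ (k+1))⁻¹ * (ball X s).indicator e x
      - (r ^ (k+1))⁻¹ * (ball X r).indicator e x)) =
      (k + 1 : ℝ) * ((s ^ (k+1))⁻¹ * (∫ y in ball X s, e y) - (r ^ (k+1))⁻¹ * ∫ y in ball X r, e y) := by
    rw [integral_const_mul, integral_sub (hQs.const_mul _) (hQr.const_mul _), integral_const_mul,
      integral_const_mul, integral_indicator measurableSet_ball,
      integral_indicator measurableSet_ball]
  have hle : ∫ x, ((k + 1 : ℝ) * ((s ^ (k+1))⁻¹ * (ball X s).indicator e x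
      - (r ^ (k+1))⁻¹ * (ball X r).indicator e x)) ≤
      ∫ x, ∑ i, (deriv (fun t : ℝ => monoEta (k+1) s r X (x + t • b i)) 0 * G i x
      + monoEta (k+1) s r X x * fderiv ℝ (G i) x (b i)) := by
    refine integral_mono_ae (((hQs.const_mul _).sub (hQr.const_mul _)).const_mul _) hPi ?_
    have hns : ∀ᵐ x ∂(volume : Measure (EuclideanSpace ℝ (Fin (k+1+1)))), x ∉ sphere X s :=
      measure_eq_zero_iff_ae_notMem.1 (Measure.addHaar_sphere_of_ne_zero _ X hs0.ne')
    have hnr : ∀ᵐ x ∂(volume : Measure (EuclideanSpace ℝ (Fin (k+1+1)))), x ∉ sphere X r :=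
      measure_eq_zero_iff_ae_notMem.1 (Measure.addHaar_sphere_of_ne_zero _ X hr0.ne')
    filter_upwards [hns, hnr] with x hxs hxr
    rw [mem_sphere_iff_norm] at hxs hxr
    rcases lt_or_gt_of_ne hxr with hxr | hxr
    · have hxΩ : x ∈ Ω := hball (by rw [mem_closedBall_iff_norm]; linarith)
      have hxb : x ∈ ball X r := by rwa [mem_ball_iff_norm]
      have hGe : ∀ i, G i =ᶠ[𝓝 x] monoV ε W u X i := by
        intro i
        filter_upwards [χ.eventuallyEq_one_of_mem_ball (x := x) hxb] with y hy
        simp [G, hy]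
      have hdiv := mono_div hΩ ε hε hu hW X hxΩ (heq x hxΩ)
      have hM := hModica x hxΩ
      rw [mono_norm_sq] at hM
      have hdge : (k + 1 : ℝ) * e x ≤ ∑ i, fderiv ℝ (monoV ε W u X i) x (b i) := by
        rw [hdiv, he, monoE]
        push_cast
        linarith
      have hPx : ∑ i, (deriv (fun t : ℝ => monoEta (k+1) s r X (x + t • b i)) 0 * G i x
          + monoEta (k+1) s r X x * fderiv ℝ (G i) x (b i)) =
          ∑ i, deriv (fun t : ℝ => monoEta (k+1) s r X (x + t • b i)) 0 * monoV ε W u X i x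
          + monoEta (k+1) s r X x * ∑ i, fderiv ℝ (monoV ε W u X i) x (b i) := by
        rw [Finset.sum_add_distrib, Finset.mul_sum]
        congr 1
        · exact Finset.sum_congr rfl fun i _ => by rw [(hGe i).self_of_nhds]
        · exact Finset.sum_congr rfl fun i _ => by rw [(hGe i).fderiv_eq]
      rw [hPx, Set.indicator_of_mem hxb]
      have hmul := mul_le_mul_of_nonneg_left hdge (monoEta_nonneg (k+1) s r X x)
      rcases lt_or_gt_of_ne hxs with hxs | hxs
      · rw [Set.indicator_of_mem (by rwa [mem_ball_iff_norm])]
        simp_rw [monoEta_deriv_in (k+1) hs0 hsr hxs]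
        rw [monoEta_in (k+1) hs0 hsr hxs] at hmul ⊢
        simp only [zero_mul, Finset.sum_const_zero, zero_add]
        linarith
      · rw [Set.indicator_of_notMem (by rw [mem_ball_iff_norm]; linarith)]
        simp_rw [monoEta_deriv_mid k hs0 hxs hxr]
        rw [monoEta_mid (k+1) hs0 hxs hxr] at hmul ⊢
        have hpos : 0 < ‖x - X‖ := hs0.trans hxs
        have hnorm : ‖x - X‖ ^ 2 = ∑ i, (x i - X i) ^ 2 := by
          rw [EuclideanSpace.norm_sq_eq]
          simp
        have hYV : ∑ i, (x i - X i) * monoV ε W u X i x ≤ e x * ‖x - X‖ ^ 2 := by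
          have : ∑ i, (x i - X i) * monoV ε W u X i x = e x * ‖x - X‖ ^ 2
              - ε * (∑ j, (x j - X j) * fderiv ℝ u x (b j)) ^ 2 := by
            rw [hnorm, sq (∑ j, (x j - X j) * fderiv ℝ u x (b j)), Finset.mul_sum, ← mul_assoc,
              Finset.mul_sum Finset.univ _ (ε * ∑ j, (x j - X j) * fderiv ℝ u x (b j)),
              ← Finset.sum_sub_distrib]
            refine Finset.sum_congr rfl fun i _ => ?_
            simp only [monoV, he, hb]
            ring
          rw [this]
          have : 0 ≤ ε * (∑ j, (x j - X j) * fderiv ℝ u x (b j)) ^ 2 := by positivity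
          linarith
        have hsum : ∑ i, -((k + 1 : ℝ) * (‖x - X‖ ^ (k + 3))⁻¹ * inner ℝ (x - X) (b i))
            * monoV ε W u X i x
            = -((k + 1 : ℝ) * (‖x - X‖ ^ (k + 3))⁻¹ * ∑ i, (x i - X i) * monoV ε W u X i x) := by
          rw [Finset.mul_sum, ← Finset.sum_neg_distrib]
          refine Finset.sum_congr rfl fun i _ => ?_
          rw [hb, EuclideanSpace.inner_single_right]
          simp
          ring
        rw [hsum]
        have h5 : (k + 1 : ℝ) * (‖x - X‖ ^ (k + 3))⁻¹ * ∑ i, (x i - X i) * monoV ε W u X i x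
            ≤ (k + 1 : ℝ) * (‖x - X‖ ^ (k + 3))⁻¹ * (e x * ‖x - X‖ ^ 2) :=
          mul_le_mul_of_nonneg_left hYV (by positivity)
        have h6 : (k + 1 : ℝ) * (‖x - X‖ ^ (k + 3))⁻¹ * (e x * ‖x - X‖ ^ 2)
            = (k + 1 : ℝ) * (‖x - X‖ ^ (k + 1))⁻¹ * e x := by
          field_simp
          try ring
        rw [h6] at h5
        linarith
    · rw [Set.indicator_of_notMem (by rw [mem_ball_iff_norm]; linarith),
        Set.indicator_of_notMem (by rw [mem_ball_iff_norm]; linarith)]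
      simp_rw [monoEta_deriv_out (k+1) hs0 hsr hxr, monoEta_out (k+1) hs0 hsr hxr]
      simp
  rw [hP0, hQ] at hle
  have hk : (0:ℝ) < k + 1 := by positivity
  have := nonpos_of_mul_nonpos_right hle hk
  linarith
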